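/- arXiv:math/0606239 — 2 statements merged into one kernel-verified Lean document; each statement's English description precedes it below -/
import Mathlib

section
/- Let $a,c\in\mathbb{N}$, $d\in\mathbb{Z}$, and $\mu$ an integer with $\mu^2\equiv d\pmod{4a^2c^2}$. If integers $p,q$ satisfy $p^2-dq^2=\pm 4ac$ and $p\equiv \mu q\pmod{2ac}$, then $\gcd(a,\gcd(p,q))=1$. -/
/-- Remark 2.1 of the paper: if `p² - d q² = ±4ac`, `p ≡ μ q (mod 2ac)` and
`μ² ≡ d (mod 4a²c²)`, then `(a, p, q) = 1`. -/
theorem stmt1 (a c : ℕ) (ha : 1 ≤ a) (hc : 1 ≤ c) (d μ p q ε : ℤ)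
    (hε : ε = 1 ∨ ε = -1)
    (hdvd : (2 * a * c : ℤ) ∣ (p - μ * q))
    (hcong : (4 * a ^ 2 * c ^ 2 : ℤ) ∣ (μ ^ 2 - d))
    (heq : p ^ 2 - d * q ^ 2 = ε * (4 * a * c)) :
    Nat.gcd a (Int.gcd p q) = 1 := by
  obtain ⟨k, hk⟩ := hdvd
  obtain ⟨m, hm⟩ := hcong
  have hne : (4 * a * c : ℤ) ≠ 0 := by positivity
  have hform : ε = a * (c * m * q ^ 2 + c * k ^ 2) + q * (k * μ) := by
    apply mul_right_cancel₀ hne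
    rw [← heq, eq_add_of_sub_eq hk, show d = μ ^ 2 - 4 * a ^ 2 * c ^ 2 * m by linarith]
    ring
  have hga : ((Nat.gcd a (Int.gcd p q) : ℕ) : ℤ) ∣ a :=
    Int.natCast_dvd_natCast.mpr (Nat.gcd_dvd_left _ _)
  have hgq : ((Nat.gcd a (Int.gcd p q) : ℕ) : ℤ) ∣ q :=
    (Int.natCast_dvd_natCast.mpr (Nat.gcd_dvd_right _ _)).trans (Int.gcd_dvd_right _ _)
  have hgε : ((Nat.gcd a (Int.gcd p q) : ℕ) : ℤ) ∣ ε :=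
    hform ▸ dvd_add (hga.mul_right _) (hgq.mul_right _)
  have hunit : IsUnit ((Nat.gcd a (Int.gcd p q) : ℕ) : ℤ) :=
    isUnit_of_dvd_unit hgε (Int.isUnit_iff.mpr hε)
  simpa using Int.isUnit_iff_natAbs_eq.mp hunit
end

section
/- Let $a,b,c\in\mathbb{N}$ with $\gcd(a,b)=1$, $d\ge 1$ with $\gcd(d,bc)=1$. In the lattice $L=U^{(1)}\oplus U^{(2)}$ (two hyperbolic planes), set $v=ac\,e_1+bc\,e_2+abc^2f_1+f_2$ and $v_1=d^2ac\,e_1+bc\,e_2+dabc^2f_1+df_2$. Then there is an isometry $\phi: v^\perp/\mathbb{Z}v \to v_1^\perp/\mathbb{Z}v_1$ sending $\bar\alpha\mapsto\bar\alpha_1$ and $\bar\beta\mapsto\tilde\beta_1$, and $\phi$ maps $\tilde t=-a\bar\alpha-b\bar\beta$ to $\tilde t_1=-a\bar\alpha_1-b\tilde\beta_1$. -/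
/-- The bilinear form of `U⁽¹⁾ ⊕ U⁽²⁾` as a `ℤ`-bilinear map. -/
def Bl : (Fin 4 → ℤ) →ₗ[ℤ] (Fin 4 → ℤ) →ₗ[ℤ] ℤ :=
  LinearMap.mk₂ ℤ
    (fun x y => -(x 0 * y 1) - x 1 * y 0 + x 2 * y 3 + x 3 * y 2)
    (fun m₁ m₂ n => by simp [Pi.add_apply]; ring)
    (fun k m n => by simp [Pi.smul_apply, smul_eq_mul]; ring)
    (fun m n₁ n₂ => by simp [Pi.add_apply]; ring)
    (fun k m n => by simp [Pi.smul_apply, smul_eq_mul]; ring)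

/-- The orthogonal complement `u^⊥` inside `ℤ⁴`. -/
def perp (u : Fin 4 → ℤ) : Submodule ℤ (Fin 4 → ℤ) :=
  LinearMap.ker (Bl.flip u)

/-- The quotient lattice `u^⊥ / ℤu`. -/
abbrev Qt (u : Fin 4 → ℤ) :=
  perp u ⧸ (Submodule.comap (perp u).subtype (Submodule.span ℤ {u}))

theorem Bl_apply (x y : Fin 4 → ℤ) :
    Bl x y = -(x 0 * y 1) - x 1 * y 0 + x 2 * y 3 + x 3 * y 2 := rfl

theorem Bl_comm (x y : Fin 4 → ℤ) : Bl x y = Bl y x := by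
  simp only [Bl_apply]; ring

theorem mem_perp {u x : Fin 4 → ℤ} : x ∈ perp u ↔ Bl x u = 0 := Iff.rfl

/-- If `u^⊥` is spanned by a hyperbolic pair `x, y` together with the isotropic vector `u`, then
`u^⊥ / ℤu` is a hyperbolic plane, with coordinates dual to the classes of `x` and `y`. -/
theorem exists_equiv_of_hyperbolic_pair (u : Fin 4 → ℤ) (x y : perp u) (huu : Bl u u = 0)
    (hxx : Bl (x : Fin 4 → ℤ) x = 0) (hyy : Bl (y : Fin 4 → ℤ) y = 0)
    (hxy : Bl (x : Fin 4 → ℤ) y = -1)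
    (hspan : ∀ z ∈ perp u, ∃ m n k : ℤ, z = m • (x : Fin 4 → ℤ) + n • (y : Fin 4 → ℤ) + k • u) :
    ∃ e : Qt u ≃ₗ[ℤ] ℤ × ℤ,
      e (Submodule.Quotient.mk x) = (1, 0) ∧ e (Submodule.Quotient.mk y) = (0, 1) ∧
      ∀ z w : perp u, Bl (z : Fin 4 → ℤ) w =
        -((e (Submodule.Quotient.mk z)).1 * (e (Submodule.Quotient.mk w)).2)
          - (e (Submodule.Quotient.mk z)).2 * (e (Submodule.Quotient.mk w)).1 := by
  have hyx : Bl (y : Fin 4 → ℤ) x = -1 := by rw [Bl_comm, hxy]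
  have hxu : Bl (x : Fin 4 → ℤ) u = 0 := x.2
  have hyu : Bl (y : Fin 4 → ℤ) u = 0 := y.2
  have hux : Bl u x = 0 := by rw [Bl_comm, hxu]
  have huy : Bl u y = 0 := by rw [Bl_comm, hyu]
  let P : perp u →ₗ[ℤ] ℤ × ℤ :=
    (LinearMap.prod (-Bl.flip (y : Fin 4 → ℤ)) (-Bl.flip (x : Fin 4 → ℤ))).comp (perp u).subtype
  have hP (z : perp u) : P z = (-Bl (z : Fin 4 → ℤ) y, -Bl (z : Fin 4 → ℤ) x) := rfl
  have hker : Submodule.comap (perp u).subtype (Submodule.span ℤ {u}) = LinearMap.ker P := by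
    ext z
    rw [Submodule.mem_comap, Submodule.mem_span_singleton, LinearMap.mem_ker, hP]
    constructor
    · rintro ⟨k, hk⟩
      rw [Submodule.subtype_apply] at hk
      simp [-zsmul_eq_mul, ← hk, hux, huy]
    · intro h
      obtain ⟨m, n, k, hz⟩ := hspan z z.2
      rw [hz] at h
      simp [-zsmul_eq_mul, hxx, hyy, hxy, hyx, hux, huy] at h
      exact ⟨k, by simp [-zsmul_eq_mul, hz, h.1, h.2]⟩
  have hsurj : Function.Surjective P := fun p =>
    ⟨p.1 • x + p.2 • y, by ext <;> simp [-zsmul_eq_mul, hP, hxx, hyy, hxy, hyx]⟩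
  let e : Qt u ≃ₗ[ℤ] ℤ × ℤ :=
    (Submodule.quotEquivOfEq _ _ hker).trans (P.quotKerEquivOfSurjective hsurj)
  have he (z : perp u) : e (Submodule.Quotient.mk z) = P z := rfl
  refine ⟨e, ?_, ?_, fun z w => ?_⟩
  · simp [he, hP, hxx, hxy]
  · simp [he, hP, hyy, hyx]
  · obtain ⟨m, n, k, hz⟩ := hspan z z.2
    obtain ⟨m', n', k', hw⟩ := hspan w w.2
    rw [he, he, hP, hP, hz, hw]
    simp [-zsmul_eq_mul, hxx, hyy, hxy, hyx, hux, huy, hxu, hyu, huu]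
    ring

/-- There is an isometry `φ : v^⊥/ℤv → v₁^⊥/ℤv₁` with `φ(ᾱ) = ᾱ₁`,
`φ(β̄) = βt₁` (where `d·βt₁ = β̄₁`), and `φ` carries `t̃ = -aᾱ - bβ̄` to
`t̃₁ = -aᾱ₁ - bβt₁`. -/
theorem stmt15 (a b c d : ℕ) (ha : 1 ≤ a) (hb : 1 ≤ b) (hc : 1 ≤ c) (hd : 1 ≤ d)
    (hab : Nat.gcd a b = 1) (hcop : Nat.gcd d (b * c) = 1)
    (v v₁ : Fin 4 → ℤ)
    (hv : v = ![(a * c : ℤ), b * c, a * b * c ^ 2, 1])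
    (hv₁ : v₁ = ![(d ^ 2 * a * c : ℤ), b * c, d * a * b * c ^ 2, d])
    (α β : perp v) (α₁ β₁ : perp v₁)
    (hα : (α : Fin 4 → ℤ) = ![1, 0, (b * c : ℤ), 0])
    (hβ : (β : Fin 4 → ℤ) = ![0, 1, (a * c : ℤ), 0])
    (hα₁ : (α₁ : Fin 4 → ℤ) = ![(d : ℤ), 0, b * c, 0])
    (hβ₁ : (β₁ : Fin 4 → ℤ) = ![0, 1, (d * a * c : ℤ), 0]) :
    ∃ (βt₁ : Qt v₁) (φ : Qt v ≃ₗ[ℤ] Qt v₁),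
      -- `βt₁` is the class with `d·βt₁ = β̄₁`:
      (d : ℤ) • βt₁ = Submodule.Quotient.mk β₁ ∧
      -- `φ` is an isometry (the forms descend to the quotients):
      (∀ (ξ η : perp v) (ξ' η' : perp v₁),
        φ (Submodule.Quotient.mk ξ) = Submodule.Quotient.mk ξ' →
        φ (Submodule.Quotient.mk η) = Submodule.Quotient.mk η' →
        Bl (ξ' : Fin 4 → ℤ) (η' : Fin 4 → ℤ) = Bl (ξ : Fin 4 → ℤ) (η : Fin 4 → ℤ)) ∧
      -- `φ(ᾱ) = ᾱ₁` and `φ(β̄) = βt₁`: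
      φ (Submodule.Quotient.mk α) = Submodule.Quotient.mk α₁ ∧
      φ (Submodule.Quotient.mk β) = βt₁ ∧
      -- `φ(t̃) = t̃₁`, where `t̃ = -aᾱ - bβ̄` and `t̃₁ = -aᾱ₁ - bβt₁`:
      φ ((-(a : ℤ)) • Submodule.Quotient.mk α - (b : ℤ) • Submodule.Quotient.mk β)
        = (-(a : ℤ)) • (Submodule.Quotient.mk α₁ : Qt v₁) - (b : ℤ) • βt₁ := by
  obtain ⟨p, q, hpq⟩ : ∃ p q : ℤ, p * d + q * (b * c) = 1 := by
    obtain ⟨p, q, h⟩ := Int.isCoprime_iff_gcd_eq_one.mpr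
      (show Int.gcd (d : ℤ) ((b * c : ℕ) : ℤ) = 1 by exact_mod_cast hcop)
    exact ⟨p, q, by push_cast at h; exact h⟩
  have hd0 : (d : ℤ) ≠ 0 := by omega
  have hmem : ![-(q * a * c * d), p, p * (d * a * c), -q] ∈ perp v₁ := by
    rw [mem_perp, Bl_apply, hv₁]; simp; ring
  obtain ⟨y, hy⟩ : ∃ y : perp v₁,
      (y : Fin 4 → ℤ) = ![-(q * a * c * d), p, p * (d * a * c), -q] := ⟨⟨_, hmem⟩, rfl⟩
  obtain ⟨e, heα, heβ, hform⟩ := exists_equiv_of_hyperbolic_pair v α β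
    (by rw [Bl_apply, hv]; simp; ring) (by rw [Bl_apply, hα]; simp)
    (by rw [Bl_apply, hβ]; simp) (by rw [Bl_apply, hα, hβ]; simp) (by
      intro z hz
      rw [mem_perp, Bl_apply, hv] at hz
      simp at hz
      refine ⟨z 0 - a * c * z 3, z 1 - b * c * z 3, z 3, ?_⟩
      rw [hα, hβ, hv]
      ext i
      fin_cases i <;> simp
      · ring
      · ring
      · linear_combination hz)
  obtain ⟨e₁, he₁α, he₁y, hform₁⟩ := exists_equiv_of_hyperbolic_pair v₁ α₁ y
    (by rw [Bl_apply, hv₁]; simp; ring) (by rw [Bl_apply, hα₁]; simp)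
    (by rw [Bl_apply, hy]; simp; ring)
    (by rw [Bl_apply, hα₁, hy]; simp; linear_combination -hpq) (by
      intro z hz
      rw [mem_perp, Bl_apply, hv₁] at hz
      simp at hz
      obtain ⟨r, hr⟩ : (d : ℤ) ∣ z 0 :=
        ⟨p * z 0 + q * (z 2 - d * a * c * z 1 + a * b * c ^ 2 * z 3), by
          linear_combination -z 0 * hpq - q * hz⟩
      have hz2 : z 2 = b * c * r + d * a * c * z 1 - a * b * c ^ 2 * z 3 := by
        apply mul_left_cancel₀ hd0
        linear_combination hz + b * c * hr
      refine ⟨r - a * c * z 3, d * z 1 - b * c * z 3, q * z 1 + p * z 3, ?_⟩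
      rw [hα₁, hy, hv₁]
      ext i
      fin_cases i <;> simp
      · linear_combination hr - d * a * c * z 3 * hpq
      · linear_combination -z 1 * hpq
      · linear_combination hz2 - d * a * c * z 1 * hpq
      · linear_combination -z 3 * hpq)
  refine ⟨Submodule.Quotient.mk y, e.trans e₁.symm, ?_, ?_, ?_, ?_, ?_⟩
  · rw [← Submodule.Quotient.mk_smul, Submodule.Quotient.eq, Submodule.mem_comap,
      Submodule.mem_span_singleton]
    refine ⟨-q, ?_⟩
    simp only [Submodule.subtype_apply, Submodule.coe_sub, Submodule.coe_smul]
    rw [hy, hβ₁, hv₁]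
    ext i
    fin_cases i <;> simp
    · ring
    · linear_combination -hpq
    · linear_combination (-d * a * c) * hpq
    · ring
  · intro ξ η ξ' η' hξ hη
    rw [LinearEquiv.trans_apply, LinearEquiv.symm_apply_eq] at hξ hη
    rw [hform, hform₁, hξ, hη]
  · simp [LinearEquiv.symm_apply_eq, heα, he₁α]
  · simp [LinearEquiv.symm_apply_eq, heβ, he₁y]
  · simp [LinearEquiv.symm_apply_eq, heα, he₁α, heβ, he₁y]
end
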